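/- arXiv:2503.16757 — 2 statements merged into one kernel-verified Lean document; each statement's English description precedes it below -/
import Mathlib

section
/- Let X be a compact metric space, μ a Borel probability measure on X, and f : X → X a μ-expansive homeomorphism. Then the set of points with converging semi-orbits under f has μ-measure 0. -/
open MeasureTheory Set Filter

/-- `Γ_δ(x)` for a bijection `f`: points whose full orbit stays `δ`-close to that of `x`. -/
def Gamma {X : Type*} [MetricSpace X] (f : Equiv.Perm X) (δ : ℝ) (x : X) : Set X :=
  {y | ∀ n : ℤ, dist ((f ^ n) x) ((f ^ n) y) ≤ δ}

/-- `f` is `μ`-expansive. -/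
def MeasureExpansive {X : Type*} [MetricSpace X] [MeasurableSpace X]
    (μ : Measure X) (f : Equiv.Perm X) : Prop :=
  ∃ δ > (0 : ℝ), ∀ x : X, μ (Gamma f δ x) = 0

/-- The set `A(f)` of points with converging semi-orbits under `f`. -/
def convergingSemiOrbits {X : Type*} [MetricSpace X] (f : X ≃ₜ X) : Set X :=
  {z | (∃ q : X, Tendsto (fun k : ℕ => (f.toEquiv ^ (k : ℤ)) z) atTop (nhds q)) ∧
       (∃ p : X, Tendsto (fun k : ℕ => (f.toEquiv ^ (-(k : ℤ))) z) atTop (nhds p))}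

/-- Integer powers of a homeomorphism are continuous. -/
theorem Homeomorph.continuous_toEquiv_zpow {X : Type*} [TopologicalSpace X] (f : X ≃ₜ X) (n : ℤ) :
    Continuous ⇑((f.toEquiv : Equiv.Perm X) ^ n) := by
  induction n with
  | zero => exact continuous_id
  | succ n ih =>
    rw [zpow_add_one]
    exact ih.comp f.continuous
  | pred n ih =>
    rw [zpow_sub_one]
    exact ih.comp f.symm.continuous

/-- Points whose semi-orbits, from time `N` on, stay `ε`-close to their positions at times `±N`. -/
def tailStableSet {X : Type*} [MetricSpace X] (f : Equiv.Perm X) (ε : ℝ) (N : ℕ) : Set X :=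
  {z | ∀ k : ℕ, N ≤ k → dist ((f ^ (k : ℤ)) z) ((f ^ (N : ℤ)) z) ≤ ε ∧
    dist ((f ^ (-(k : ℤ))) z) ((f ^ (-(N : ℤ))) z) ≤ ε}

theorem convergingSemiOrbits_subset_iUnion_tailStableSet {X : Type*} [MetricSpace X]
    (f : X ≃ₜ X) {ε : ℝ} (hε : 0 < ε) :
    convergingSemiOrbits f ⊆ ⋃ N, tailStableSet f.toEquiv ε N := by
  rintro z ⟨⟨q, hq⟩, p, hp⟩
  obtain ⟨N, hN⟩ := Metric.cauchySeq_iff.1 hq.cauchySeq ε hε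
  obtain ⟨M, hM⟩ := Metric.cauchySeq_iff.1 hp.cauchySeq ε hε
  refine mem_iUnion.2 ⟨max N M, fun k hk => ⟨?_, ?_⟩⟩
  · exact (hN k ((le_max_left N M).trans hk) _ (le_max_left N M)).le
  · exact (hM k ((le_max_right N M).trans hk) _ (le_max_right N M)).le

/-- Near each of its points, a tail-stable set is contained in a dynamical ball. -/
theorem Gamma_mem_nhdsWithin_tailStableSet {X : Type*} [MetricSpace X] (f : X ≃ₜ X) {δ : ℝ}
    (hδ : 0 < δ) {N : ℕ} {x : X} (hx : x ∈ tailStableSet f.toEquiv (δ / 3) N) :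
    Gamma f.toEquiv δ x ∈ nhdsWithin x (tailStableSet f.toEquiv (δ / 3) N) := by
  have hev : ∀ᶠ y in nhds x, ∀ n ∈ Icc (-(N : ℤ)) N,
      dist ((f.toEquiv ^ n) y) ((f.toEquiv ^ n) x) < δ / 3 := by
    refine (eventually_all_finite (finite_Icc _ _)).2 fun n _ => ?_
    exact (f.continuous_toEquiv_zpow n).continuousAt.eventually
      (Metric.ball_mem_nhds _ (by positivity))
  filter_upwards [mem_nhdsWithin_of_mem_nhds hev, self_mem_nhdsWithin] with y hy hyN n
  by_cases hn : n ∈ Icc (-(N : ℤ)) N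
  · have := hy n hn
    rw [dist_comm] at this
    linarith
  · have tail : ∀ {a b c d : X}, dist a b ≤ δ / 3 → dist c d ≤ δ / 3 → dist d b < δ / 3 →
        dist a c ≤ δ := fun {a b c d} hab hcd hdb => by
      have := dist_triangle4 a b d c
      rw [dist_comm b d, dist_comm d c] at this
      linarith
    obtain ⟨k, rfl | rfl⟩ := n.eq_nat_or_neg
    · have hk : N ≤ k := by simp only [mem_Icc] at hn; omega
      exact tail (hx k hk).1 (hyN k hk).1 (hy _ (by simp))
    · have hk : N ≤ k := by simp only [mem_Icc] at hn; omega
      exact tail (hx k hk).2 (hyN k hk).2 (hy _ (by simp))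

theorem measure_convergingSemiOrbits_eq_zero {X : Type*} [MetricSpace X] [CompactSpace X]
    [MeasurableSpace X] [BorelSpace X] (μ : Measure X) [IsProbabilityMeasure μ]
    (f : X ≃ₜ X) (hf : MeasureExpansive μ f.toEquiv) :
    μ (convergingSemiOrbits f) = 0 := by
  obtain ⟨δ, hδ, hΓ⟩ := hf
  have : SecondCountableTopology X := EMetric.secondCountable_of_sigmaCompact X
  refine measure_mono_null
    (convergingSemiOrbits_subset_iUnion_tailStableSet f (by positivity : 0 < δ / 3))
    (measure_iUnion_null fun N => measure_null_of_locally_null _ fun x hx => ?_)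
  exact ⟨_, Gamma_mem_nhdsWithin_tailStableSet f hδ hx, hΓ x⟩
end

section
/- Let a < b be real numbers and I = [a,b]. For every homeomorphism f : I → I and every Borel probability measure μ on I, f is not μ-expansive. -/
open MeasureTheory Set Filter

theorem Gamma_inv {X : Type*} [MetricSpace X] (f : Equiv.Perm X) (δ : ℝ) (x : X) :
    Gamma f⁻¹ δ x = Gamma f δ x := by
  ext y
  simp only [Gamma, Set.mem_ofPred_eq, inv_zpow']
  exact ⟨fun h n => by simpa using h (-n), fun h n => h (-n)⟩

theorem MeasureExpansive.mul_self {X : Type*} [MetricSpace X] [CompactSpace X]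
    [MeasurableSpace X] {μ : Measure X} {f : Equiv.Perm X} (hf : Continuous f)
    (h : MeasureExpansive μ f) : MeasureExpansive μ (f * f) := by
  obtain ⟨δ, hδ, h⟩ := h
  obtain ⟨ε, hε, hfε⟩ := Metric.uniformContinuous_iff.1
    (CompactSpace.uniformContinuous_of_continuous hf) δ hδ
  refine ⟨min δ (ε / 2), by positivity, fun x => measure_mono_null ?_ (h x)⟩
  intro y hy n
  obtain ⟨k, rfl | rfl⟩ := Int.even_or_odd' n
  · have := hy k
    rw [← pow_two, ← zpow_natCast, ← zpow_mul] at this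
    exact this.trans (min_le_left _ _)
  · have := hy k
    rw [← pow_two, ← zpow_natCast, ← zpow_mul] at this
    rw [add_comm, zpow_add, zpow_one, Equiv.Perm.mul_apply, Equiv.Perm.mul_apply]
    exact (hfε ((this.trans (min_le_right _ _)).trans_lt (half_lt_self hε))).le

theorem OrderIso.toEquiv_zpow {X : Type*} [LE X] (g : X ≃o X) (n : ℤ) :
    (g.toEquiv : Equiv.Perm X) ^ n = (g ^ n).toEquiv :=
  let φ : (X ≃o X) →* Equiv.Perm X :=
    { toFun := fun e => e.toEquiv, map_one' := rfl, map_mul' := fun _ _ => rfl }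
  (map_zpow φ g n).symm

theorem tendsto_sub_cofinite_of_monotone_int {u : ℤ → ℝ} (hu : Monotone u)
    (hb : BddBelow (range u)) (ha : BddAbove (range u)) :
    Tendsto (fun n => u (n + 1) - u (n - 1)) cofinite (nhds 0) := by
  rw [Int.cofinite_eq, tendsto_sup]
  constructor
  · have h := tendsto_atBot_ciInf hu hb
    simpa [sub_eq_add_neg] using (h.comp (tendsto_atBot_add_const_right _ 1 tendsto_id)).sub
      (h.comp (tendsto_atBot_add_const_right _ (-1) tendsto_id))
  · have h := tendsto_atTop_ciSup hu ha
    simpa [sub_eq_add_neg] using (h.comp (tendsto_atTop_add_const_right _ 1 tendsto_id)).sub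
      (h.comp (tendsto_atTop_add_const_right _ (-1) tendsto_id))

theorem Gamma_mem_nhds_of_lt {a b : ℝ} (g : Icc a b ≃o Icc a b) {δ : ℝ} (hδ : 0 < δ)
    {x : Icc a b} (hx : x < g x) : Gamma g.toEquiv δ x ∈ nhds x := by
  have hsucc (n : ℤ) : (g ^ n) (g x) = (g ^ (n + 1)) x := by rw [zpow_add_one]; rfl
  have hpred (n : ℤ) : (g ^ n) (g⁻¹ x) = (g ^ (n - 1)) x := by rw [zpow_sub_one]; rfl
  have hmono : Monotone fun n : ℤ => (((g ^ n) x : Icc a b) : ℝ) :=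
    monotone_int_of_le_succ fun n => by
      rw [← hsucc]
      exact (g ^ n).monotone hx.le
  have htend := tendsto_sub_cofinite_of_monotone_int hmono
    ⟨a, by rintro _ ⟨n, rfl⟩; exact ((g ^ n) x).2.1⟩
    ⟨b, by rintro _ ⟨n, rfl⟩; exact ((g ^ n) x).2.2⟩
  have hfin : {n : ℤ | ¬ (((g ^ (n + 1)) x : ℝ) - ((g ^ (n - 1)) x : ℝ) < δ)}.Finite :=
    htend.eventually (gt_mem_nhds hδ)
  have hnear : ∀ᶠ y in nhds x, ∀ n ∈ {n : ℤ | ¬ (((g ^ (n + 1)) x : ℝ) -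
      ((g ^ (n - 1)) x : ℝ) < δ)}, dist ((g ^ n) x) ((g ^ n) y) < δ := by
    refine (eventually_all_finite hfin).2 fun n _ => ?_
    have hc : Continuous fun y => dist ((g ^ n) x) ((g ^ n) y) :=
      continuous_const.dist (g ^ n).continuous
    exact hc.continuousAt.eventually (gt_mem_nhds (by simpa using hδ))
  have hlt : g⁻¹ x < x := g.symm_apply_lt.2 hx
  filter_upwards [hnear, Ioo_mem_nhds hlt hx] with y hy hyx n
  rw [OrderIso.toEquiv_zpow]
  change dist ((g ^ n) x) ((g ^ n) y) ≤ δ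
  by_cases hn : ((g ^ (n + 1)) x : ℝ) - ((g ^ (n - 1)) x : ℝ) < δ
  · refine le_trans ?_ hn.le
    have hy₁ : (g ^ (n - 1)) x ≤ (g ^ n) y := hpred n ▸ (g ^ n).monotone hyx.1.le
    have hy₂ : (g ^ n) y ≤ (g ^ (n + 1)) x := hsucc n ▸ (g ^ n).monotone hyx.2.le
    exact Real.dist_le_of_mem_Icc ⟨hmono (by lia), hmono (by lia)⟩ ⟨hy₁, hy₂⟩
  · exact (hy n hn).le

theorem Gamma_mem_nhds_of_ne {a b : ℝ} (g : Icc a b ≃o Icc a b) {δ : ℝ} (hδ : 0 < δ)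
    {x : Icc a b} (hx : g x ≠ x) : Gamma g.toEquiv δ x ∈ nhds x := by
  rcases hx.lt_or_gt with h | h
  · rw [← Gamma_inv]
    exact Gamma_mem_nhds_of_lt g⁻¹ hδ (g.lt_symm_apply.2 h)
  · exact Gamma_mem_nhds_of_lt g hδ h

theorem Gamma_mem_nhdsWithin_fixedPoints {X : Type*} [MetricSpace X] (f : Equiv.Perm X)
    {δ : ℝ} (hδ : 0 < δ) {x : X} (hx : f x = x) :
    Gamma f δ x ∈ nhdsWithin x (Function.fixedPoints f) := by
  filter_upwards [self_mem_nhdsWithin,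
    mem_nhdsWithin_of_mem_nhds (Metric.closedBall_mem_nhds x hδ)] with y hy hxy n
  rw [Equiv.Perm.zpow_apply_eq_self_of_apply_eq_self hx,
    Equiv.Perm.zpow_apply_eq_self_of_apply_eq_self hy, dist_comm]
  exact hxy

theorem not_measureExpansive_orderIso {a b : ℝ} (g : Icc a b ≃o Icc a b)
    (μ : Measure (Icc a b)) [NeZero μ] : ¬ MeasureExpansive μ g.toEquiv := by
  rintro ⟨δ, hδ, h⟩
  have hfix : μ (Function.fixedPoints g) = 0 := measure_null_of_locally_null _ fun x hx =>
    ⟨_, Gamma_mem_nhdsWithin_fixedPoints g.toEquiv hδ hx, h x⟩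
  have hcompl : μ (Function.fixedPoints g)ᶜ = 0 := measure_null_of_locally_null _ fun x hx =>
    ⟨_, mem_nhdsWithin_of_mem_nhds (Gamma_mem_nhds_of_ne g hδ hx), h x⟩
  refine NeZero.ne μ (Measure.measure_univ_eq_zero.1 ?_)
  rw [← union_compl_self (Function.fixedPoints g)]
  exact measure_union_null hfix hcompl

theorem no_measureExpansive_of_interval {a b : ℝ} (hab : a < b)
    (f : ↥(Set.Icc a b) ≃ₜ ↥(Set.Icc a b))
    (μ : Measure ↥(Set.Icc a b)) [IsProbabilityMeasure μ] :
    ¬ MeasureExpansive μ f.toEquiv := by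
  intro h
  have : Fact (a ≤ b) := ⟨hab.le⟩
  have hmono : StrictMono (f ∘ f) := by
    rcases f.continuous.strictMono_of_inj_boundedOrder' f.injective with hf | hf
    · exact hf.comp hf
    · exact hf.comp hf
  let g : Icc a b ≃o Icc a b :=
    ⟨(f.toEquiv * f.toEquiv : Equiv.Perm (Icc a b)), hmono.le_iff_le⟩
  exact not_measureExpansive_orderIso g μ (h.mul_self f.continuous)
end
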